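/- Let J ⊆ ℤ^n be a finite jump system and f a separable convex function. Let x ∈ J be a vector that is not an optimal solution of (JSC), and let s* = −χ_i (for some coordinate i) satisfy (descent-s) at x. Assume that x*(i) ≥ x(i) holds for every x* ∈ M*(x), and let x* ∈ M*(x) be an element with x*(i) minimal among all elements of M*(x). Then there exists u ∈ inc(x*, x) such that f(x* + u) > f(x*) and f(x − u) < f(x + s*). -/

import Mathlib

open scoped BigOperators

def l1 {n : ℕ} (x : Fin n → ℤ) : ℤ := ∑ i, |x i|

def UnitVec (n : ℕ) : Set (Fin n → ℤ) :=
  {s | ∃ i : Fin n, s = Pi.single i 1 ∨ s = -Pi.single i 1}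

def inc {n : ℕ} (x y : Fin n → ℤ) : Set (Fin n → ℤ) :=
  {s | s ∈ UnitVec n ∧ l1 (x + s - y) = l1 (x - y) - 1}

def IsJumpSystem {n : ℕ} (J : Set (Fin n → ℤ)) : Prop :=
  J.Nonempty ∧ ∀ x ∈ J, ∀ y ∈ J, ∀ s ∈ inc x y,
    x + s ∉ J → ∃ t ∈ inc (x + s) y, x + s + t ∈ J

def IsSepConvex {n : ℕ} (f : (Fin n → ℤ) → ℝ) : Prop :=
  ∃ g : Fin n → ℤ → ℝ,
    (∀ i k, 2 * g i k ≤ g i (k - 1) + g i (k + 1)) ∧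
    ∀ x, f x = ∑ i, g i (x i)

def IsOptimal {n : ℕ} (J : Set (Fin n → ℤ)) (f : (Fin n → ℤ) → ℝ) (y : Fin n → ℤ) : Prop :=
  y ∈ J ∧ ∀ z ∈ J, f y ≤ f z

noncomputable def mu {n : ℕ} (J : Set (Fin n → ℤ)) (f : (Fin n → ℤ) → ℝ) (x : Fin n → ℤ) : ℤ :=
  sInf {d : ℤ | ∃ y, IsOptimal J f y ∧ d = l1 (y - x)}

def Mstar {n : ℕ} (J : Set (Fin n → ℤ)) (f : (Fin n → ℤ) → ℝ) (x : Fin n → ℤ) : Set (Fin n → ℤ) :=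
  {y | IsOptimal J f y ∧ l1 (y - x) = mu J f x}

def DescentS {n : ℕ} (J : Set (Fin n → ℤ)) (f : (Fin n → ℤ) → ℝ) (x s : Fin n → ℤ) : Prop :=
  s ∈ UnitVec n ∧
  (∃ t, (t ∈ UnitVec n ∨ t = 0) ∧ x + s + t ∈ J ∧ f (x + s + t) < f x) ∧
  ∀ s' ∈ UnitVec n,
    (∃ t, (t ∈ UnitVec n ∨ t = 0) ∧ x + s' + t ∈ J ∧ f (x + s' + t) < f x) →
    f (x + s) ≤ f (x + s')

def DescentT {n : ℕ} (J : Set (Fin n → ℤ)) (f : (Fin n → ℤ) → ℝ) (x s t : Fin n → ℤ) : Prop :=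
  (x + s ∈ J ∧ t = 0) ∨
  (x + s ∉ J ∧ t ∈ UnitVec n ∧ x + s + t ∈ J ∧
    ∀ t' ∈ UnitVec n, x + s + t' ∈ J → f (x + s + t) ≤ f (x + s + t'))

def Sset {n : ℕ} (x s t : Fin n → ℤ) : Set (Fin n → ℤ) :=
  {y | l1 (y - (x + s + t)) = l1 (y - x) - l1 (s + t)}

def CScase {n : ℕ} (x sstar : Fin n → ℤ) (h : Fin n) (xs ss : ℕ → Fin n → ℤ) (l : ℕ) : Prop :=
  xs (l - 1) h + ss l h = x h + sstar h ∧ ss l = Pi.single h 1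

def CTcase {n : ℕ} (x sstar : Fin n → ℤ) (h : Fin n) (xs ss ts : ℕ → Fin n → ℤ) (l : ℕ) : Prop :=
  xs (l - 1) h + ss l h = x h + sstar h - 1 ∧ ts l = Pi.single h 1

theorem mem_unitVec_iff {n : ℕ} {s : Fin n → ℤ} :
    s ∈ UnitVec n ↔ ∃ j e, (e = 1 ∨ e = -1) ∧ s = Pi.single j e := by
  constructor
  · rintro ⟨j, h | h⟩
    · exact ⟨j, 1, Or.inl rfl, h⟩
    · exact ⟨j, -1, Or.inr rfl, by rw [h, Pi.single_neg]⟩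
  · rintro ⟨j, e, rfl | rfl, h⟩
    · exact ⟨j, Or.inl h⟩
    · exact ⟨j, Or.inr (by rw [h, Pi.single_neg])⟩

theorem sum_apply_add_single {n : ℕ} {M : Type*} [AddCommGroup M] (g : Fin n → ℤ → M)
    (x : Fin n → ℤ) (j : Fin n) (e : ℤ) :
    ∑ k, g k ((x + Pi.single j e : Fin n → ℤ) k) = ∑ k, g k (x k) + (g j (x j + e) - g j (x j)) := by
  rw [← sub_eq_iff_eq_add', ← Finset.sum_sub_distrib, Finset.sum_eq_single j]
  · simp
  · intro k _ hk
    simp [Pi.single_eq_of_ne hk]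
  · simp

theorem l1_add_single {n : ℕ} (x : Fin n → ℤ) (j : Fin n) (e : ℤ) :
    l1 (x + Pi.single j e) = l1 x + (|x j + e| - |x j|) :=
  sum_apply_add_single (fun _ k => |k|) x j e

theorem l1_nonneg {n : ℕ} (x : Fin n → ℤ) : 0 ≤ l1 x :=
  Finset.sum_nonneg fun _ _ => abs_nonneg _

theorem single_mem_inc_iff {n : ℕ} {x y : Fin n → ℤ} {j : Fin n} {e : ℤ} (he : e = 1 ∨ e = -1) :
    Pi.single j e ∈ inc x y ↔ 0 < e * (y j - x j) := by
  have h : l1 (x + Pi.single j e - y) = l1 (x - y) + (|x j - y j + e| - |x j - y j|) := by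
    rw [add_sub_right_comm, l1_add_single, Pi.sub_apply]
  simp only [inc, Set.mem_ofPred_eq, h]
  have hu : (Pi.single j e : Fin n → ℤ) ∈ UnitVec n := mem_unitVec_iff.2 ⟨j, e, he, rfl⟩
  simp only [hu, true_and]
  rcases he with rfl | rfl <;> grind

theorem mu_le {n : ℕ} {J : Set (Fin n → ℤ)} {f : (Fin n → ℤ) → ℝ} {x y : Fin n → ℤ}
    (hy : IsOptimal J f y) : mu J f x ≤ l1 (y - x) :=
  csInf_le ⟨0, by rintro d ⟨z, -, rfl⟩; exact l1_nonneg _⟩ ⟨y, hy, rfl⟩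

theorem slope_mono_of_convex {g : ℤ → ℝ} (hg : ∀ k, 2 * g k ≤ g (k - 1) + g (k + 1)) {a b : ℤ}
    (hab : a ≤ b) : g (a + 1) - g a ≤ g (b + 1) - g b := by
  refine monotone_int_of_le_succ (f := fun k => g (k + 1) - g k) (fun k => ?_) hab
  have := hg (k + 1)
  rw [add_sub_cancel_right] at this
  linarith

/-- Stepping back from `a` towards `b` costs at most what the opposite step from `b` gains. -/
theorem step_le_of_convex {g : ℤ → ℝ} (hg : ∀ k, 2 * g k ≤ g (k - 1) + g (k + 1)) {a b e : ℤ}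
    (he : e = 1 ∨ e = -1) (h : 0 < e * (a - b)) : g (a - e) - g a ≤ g b - g (b + e) := by
  rcases he with rfl | rfl
  · have := slope_mono_of_convex hg (a := b) (b := a - 1) (by lia)
    rw [sub_add_cancel] at this
    linarith
  · have := slope_mono_of_convex hg (a := a) (b := b + -1) (by lia)
    rw [neg_add_cancel_right] at this
    rw [sub_neg_eq_add]
    linarith

theorem IsSepConvex.exists_add_single {n : ℕ} {f : (Fin n → ℤ) → ℝ} (hf : IsSepConvex f) :
    ∃ g : Fin n → ℤ → ℝ, (∀ i k, 2 * g i k ≤ g i (k - 1) + g i (k + 1)) ∧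
      ∀ x j e, f (x + Pi.single j e) = f x + (g j (x j + e) - g j (x j)) := by
  obtain ⟨g, hg, hfg⟩ := hf
  exact ⟨g, hg, fun x j e => by rw [hfg, hfg, sum_apply_add_single]⟩

theorem step_down_antitone_of_convex {g : ℤ → ℝ} (hg : ∀ k, 2 * g k ≤ g (k - 1) + g (k + 1))
    {a b : ℤ} (hab : a ≤ b) : g (b + -1) - g b ≤ g (a + -1) - g a := by
  have := slope_mono_of_convex hg (a := a + -1) (b := b + -1) (by lia)
  rw [neg_add_cancel_right, neg_add_cancel_right] at this
  linarith

/-- The step chosen by the steepest descent rule strictly decreases the objective. -/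
theorem DescentS.lt_of_single {n : ℕ} {J : Set (Fin n → ℤ)} {f : (Fin n → ℤ) → ℝ}
    {g : Fin n → ℤ → ℝ} {x : Fin n → ℤ} {i : Fin n} (hg : ∀ i k, 2 * g i k ≤ g i (k - 1) + g i (k + 1))
    (hfg : ∀ x j e, f (x + Pi.single j e) = f x + (g j (x j + e) - g j (x j)))
    (hs : DescentS J f x (Pi.single i (-1))) :
    g i (x i + -1) < g i (x i) := by
  obtain ⟨-, ⟨t, ht, htJ, hlt⟩, hmin⟩ := hs
  rcases ht with ht | rfl
  · obtain ⟨j, e, he, rfl⟩ := mem_unitVec_iff.1 ht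
    have hmin' := hmin _ ht ⟨Pi.single i (-1), Or.inl (mem_unitVec_iff.2 ⟨i, -1, by simp, rfl⟩),
      by rwa [add_right_comm], by rwa [add_right_comm]⟩
    simp only [hfg, Pi.add_apply] at hlt hmin'
    by_cases hji : j = i
    · subst hji
      simp only [Pi.single_eq_same] at hlt
      rcases he with rfl | rfl
      · simp only [neg_add_cancel_right] at hlt
        linarith
      · have := step_down_antitone_of_convex (hg j) (a := x j + -1) (b := x j) (by lia)
        linarith
    · simp only [Pi.single_eq_of_ne hji, add_zero] at hlt
      linarith
  · simp only [add_zero, hfg] at hlt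
    linarith

theorem stmt18 {n : ℕ} (J : Set (Fin n → ℤ)) (f : (Fin n → ℤ) → ℝ)
    (x sstar xstar : Fin n → ℤ) (i : Fin n)
    (hn : 2 ≤ n) (hJ : IsJumpSystem J) (hJfin : J.Finite) (hf : IsSepConvex f)
    (hxJ : x ∈ J) (hxopt : ¬ IsOptimal J f x)
    (hsdef : sstar = -Pi.single i 1) (hs : DescentS J f x sstar)
    (hge : ∀ x' ∈ Mstar J f x, x i ≤ x' i)
    (hx1 : xstar ∈ Mstar J f x) (hx2 : ∀ x' ∈ Mstar J f x, xstar i ≤ x' i) :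
    ∃ u ∈ inc xstar x, f xstar < f (xstar + u) ∧ f (x - u) < f (x + sstar) := by
  obtain ⟨g, hg, hfg⟩ := hf.exists_add_single
  rw [← Pi.single_neg] at hsdef
  subst hsdef
  have hδ := hs.lt_of_single hg hfg
  have hi := hge _ hx1
  have hi' := step_down_antitone_of_convex (hg i) hi
  obtain ⟨hopt, hdist⟩ := hx1
  obtain ⟨-, ⟨t', ht', hyJ, hy⟩, -⟩ := hs
  have hyi : x i + t' i ≤ x i := by
    rcases ht' with ht' | rfl
    · obtain ⟨k, d, rfl | rfl, rfl⟩ := mem_unitVec_iff.1 ht'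
      · by_cases hki : k = i
        · subst hki
          simp only [hfg, Pi.add_apply, Pi.single_eq_same, neg_add_cancel_right] at hy
          linarith
        · simp [Pi.single_eq_of_ne' hki]
      · by_cases hki : k = i
        · subst hki
          simp
        · simp [Pi.single_eq_of_ne' hki]
    · simp
  have hinc : Pi.single i (-1) ∈ inc xstar (x + Pi.single i (-1) + t') := by
    rw [single_mem_inc_iff (by simp)]
    simp
    lia
  have hnot : xstar + Pi.single i (-1) ∉ J := fun h => by
    have := hopt.2 _ h
    simp only [hfg] at this
    linarith
  obtain ⟨t, htinc, htJ⟩ := hJ.2 _ hopt.1 _ hyJ _ hinc hnot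
  obtain ⟨j, e, he, rfl⟩ := mem_unitVec_iff.1 htinc.1
  rw [single_mem_inc_iff he] at htinc
  have hle := hopt.2 _ htJ
  simp only [hfg, Pi.add_apply] at hle hy htinc
  by_cases hji : j = i
  · subst hji
    exfalso
    simp only [Pi.single_eq_same] at hle htinc
    obtain rfl : e = -1 := by
      rcases he with rfl | rfl
      · lia
      · rfl
    rcases hi.lt_or_eq with hlt | heq
    · have := step_down_antitone_of_convex (hg j) (a := x j) (b := xstar j + -1) (by lia)
      linarith
    · rcases ht' with ht' | rfl
      · obtain ⟨k, d, hd, rfl⟩ := mem_unitVec_iff.1 ht'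
        by_cases hkj : k = j
        · subst hkj
          simp only [Pi.single_eq_same, hfg, Pi.add_apply] at htinc hyi hy
          obtain rfl : d = -1 := by lia
          rw [← heq] at hle
          linarith
        · simp only [Pi.single_eq_of_ne' hkj] at htinc
          lia
      · simp at htinc
        lia
  simp only [Pi.single_eq_of_ne hji, add_zero] at hle htinc
  by_cases htx : 0 < e * (x j - xstar j)
  · have hstep := step_le_of_convex (hg j) he htx
    have hne : ¬ IsOptimal J f (xstar + Pi.single i (-1) + Pi.single j e) := by
      intro ho
      have hd : l1 (xstar + Pi.single i (-1) + Pi.single j e - x)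
          = l1 (xstar - x) + (|xstar i - x i + -1| - |xstar i - x i|) - 1 := by
        rw [add_sub_right_comm, l1_add_single, add_sub_right_comm, l1_add_single]
        simp only [Pi.add_apply, Pi.sub_apply, Pi.single_eq_of_ne hji, add_zero]
        rcases he with rfl | rfl <;> grind
      have hm := mu_le (x := x) ho
      rcases hi.lt_or_eq with hlt | heq
      · grind
      · have := hge _ ⟨ho, by grind⟩
        simp [Pi.single_eq_of_ne' hji] at this
        lia
    have hlt : g i (xstar i) + g j (xstar j) < g i (xstar i + -1) + g j (xstar j + e) := by
      by_contra hcon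
      refine hne ⟨htJ, fun z hz => le_trans ?_ (hopt.2 z hz)⟩
      simp only [hfg, Pi.add_apply, Pi.single_eq_of_ne hji, add_zero]
      linarith
    refine ⟨Pi.single j e, (single_mem_inc_iff he).2 htx, ?_, ?_⟩
    · simp only [hfg]
      linarith
    · rw [sub_eq_add_neg, ← Pi.single_neg]
      simp only [hfg, ← sub_eq_add_neg] at *
      linarith
  · exfalso
    rcases ht' with ht' | rfl
    · obtain ⟨k, d, hd, rfl⟩ := mem_unitVec_iff.1 ht'
      by_cases hkj : k = j
      · subst hkj
        simp only [Pi.single_eq_same, hfg, Pi.add_apply,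
          Pi.single_eq_of_ne hji, add_zero] at htinc hy
        have : d = e ∧ xstar k = x k := by
          rcases he with rfl | rfl <;> rcases hd with rfl | rfl <;> constructor <;> lia
        rw [this.1] at hy
        rw [this.2] at hle
        linarith
      · simp only [Pi.single_eq_of_ne' hkj, add_zero] at htinc
        exact htx htinc
    · simp only [Pi.zero_apply, add_zero] at htinc
      exact htx htinc
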